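/- Suppose c = r e^{2πi p/q} with p/q in lowest terms and gcd(n,q) = 1, 0 < r < 1. For each θ ∈ Θ = {ℓ(p/q) + m/n + 1/(2n) mod 1}, the set of points of Λ_{n,c} maximizing v_θ is affinely isomorphic (via an orientation-preserving complex-affine map) to the attractor of the two-generator IFS {x ↦ r^q x, x ↦ r^q x + 1} acting on ℝ; in particular it is a Cantor set if r^q < 1/2 and an interval if r^q ≥ 1/2. -/

import Mathlib

noncomputable def xi (n : ℕ) : ℂ := Complex.exp (2 * Real.pi * Complex.I / n)

noncomputable def v (θ : ℝ) (z : ℂ) : ℝ :=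
  (z * Complex.exp (-(2 * Real.pi * Complex.I) * θ)).re

open Metric in
/-- A compact set that is covered by two contractions of itself lies in every compact set that the
same two contractions map into itself. -/
theorem subset_of_contractions {X : Type*} [MetricSpace X] {s : ℝ} (hs0 : 0 ≤ s) (hs1 : s < 1)
    {f g : X → X} (hf : ∀ x y, dist (f x) (f y) ≤ s * dist x y)
    (hg : ∀ x y, dist (g x) (g y) ≤ s * dist x y) {A B : Set X}
    (hA : IsCompact A) (hBne : B.Nonempty) (hB : IsCompact B)
    (hAsub : A ⊆ f '' A ∪ g '' A) (hBsup : f '' B ∪ g '' B ⊆ B) : A ⊆ B := by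
  have contract : ∀ h : X → X, (∀ x y, dist (h x) (h y) ≤ s * dist x y) → h '' B ⊆ B →
      ∀ y, infDist (h y) B ≤ s * infDist y B := by
    intro h hh hhB y
    obtain ⟨b, hb, hyb⟩ := hB.exists_infDist_eq_dist hBne y
    rw [hyb]
    exact (infDist_le_dist_of_mem (hhB ⟨b, hb, rfl⟩)).trans (hh y b)
  rcases A.eq_empty_or_nonempty with rfl | hAne
  · exact Set.empty_subset B
  obtain ⟨x, hx, hmax⟩ := hA.exists_isMaxOn hAne (continuous_infDist_pt B).continuousOn
  have hle : infDist x B ≤ s * infDist x B := by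
    rcases hAsub hx with ⟨y, hy, rfl⟩ | ⟨y, hy, rfl⟩
    · exact (contract f hf (Set.subset_union_left.trans hBsup) y).trans
        (mul_le_mul_of_nonneg_left (hmax hy) hs0)
    · exact (contract g hg (Set.subset_union_right.trans hBsup) y).trans
        (mul_le_mul_of_nonneg_left (hmax hy) hs0)
  have hx0 : infDist x B ≤ 0 := by nlinarith [infDist_nonneg (x := x) (s := B)]
  intro y hy
  rw [hB.isClosed.mem_iff_infDist_zero hBne]
  exact le_antisymm ((hmax hy).trans hx0) infDist_nonneg

/-- Uniqueness of the attractor of a pair of contractions. -/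
theorem attractor_unique {X : Type*} [MetricSpace X] {s : ℝ} (hs0 : 0 ≤ s) (hs1 : s < 1)
    {f g : X → X} (hf : ∀ x y, dist (f x) (f y) ≤ s * dist x y)
    (hg : ∀ x y, dist (g x) (g y) ≤ s * dist x y) {A B : Set X}
    (hAne : A.Nonempty) (hA : IsCompact A) (hBne : B.Nonempty) (hB : IsCompact B)
    (hAinv : A = f '' A ∪ g '' A) (hBinv : B = f '' B ∪ g '' B) : A = B :=
  (subset_of_contractions hs0 hs1 hf hg hA hBne hB hAinv.subset hBinv.symm.subset).antisymm
    (subset_of_contractions hs0 hs1 hf hg hB hAne hA hBinv.subset hAinv.symm.subset)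

theorem dist_mul_add_le {𝕜 : Type*} [NormedField 𝕜] (s d x y : 𝕜) :
    dist (s * x + d) (s * y + d) ≤ ‖s‖ * dist x y := by
  rw [dist_add_right, dist_eq_norm, ← mul_sub, norm_mul, dist_eq_norm]

open MeasureTheory in
theorem isTotallyDisconnected_of_attractor {s : ℝ} (hs0 : 0 ≤ s) (hs : s < 1 / 2) {K : Set ℝ}
    (hK : IsCompact K)
    (hinv : K = (fun x => s * x) '' K ∪ (fun x => s * x + 1) '' K) :
    IsTotallyDisconnected K := by
  have hscale : volume.real ((fun x => s * x) '' K) = s * volume.real K := by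
    have := Measure.addHaar_image_homothety (volume : Measure ℝ) 0 s K
    have himage : (AffineMap.homothety 0 s : ℝ → ℝ) '' K = (fun x => s * x) '' K := by
      congr 1; ext x; simp [AffineMap.homothety_apply]
    rw [himage, Module.finrank_self, pow_one, abs_of_nonneg hs0] at this
    rw [measureReal_def, this, ENNReal.toReal_mul, ENNReal.toReal_ofReal hs0, measureReal_def]
  have htrans : volume.real ((fun x => s * x + 1) '' K) = s * volume.real K := by
    rw [← hscale, ← Set.image_image (fun x => x + 1) (fun x => s * x)]
    simp [measureReal_def]
  have hvol : volume.real K = 0 := by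
    have h := measureReal_union_le (μ := volume) ((fun x => s * x) '' K)
      ((fun x => s * x + 1) '' K)
    rw [← hinv, hscale, htrans] at h
    have := measureReal_nonneg (μ := volume) (s := K)
    nlinarith
  have no_interval : ∀ x y, x < y → ¬ Set.Icc x y ⊆ K := by
    intro x y hxy hsub
    have h := measureReal_mono (μ := volume) hsub hK.measure_lt_top.ne
    rw [hvol, Real.volume_real_Icc_of_le hxy.le] at h
    linarith
  intro t ht hconn x hx y hy
  by_contra hne
  rcases lt_or_gt_of_ne hne with h | h
  · exact no_interval x y h ((hconn.ordConnected.out hx hy).trans ht)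
  · exact no_interval y x h ((hconn.ordConnected.out hy hx).trans ht)

theorem attractor_eq_Icc {s : ℝ} (hs : 1 / 2 ≤ s) (hs1 : s < 1) {K : Set ℝ} (hne : K.Nonempty)
    (hK : IsCompact K)
    (hinv : K = (fun x => s * x) '' K ∪ (fun x => s * x + 1) '' K) :
    K = Set.Icc 0 (1 / (1 - s)) := by
  have hs0 : 0 < s := by linarith
  have h1s : 0 < 1 - s := by linarith
  set L := 1 / (1 - s) with hL
  have hL1 : L * (1 - s) = 1 := by rw [hL]; field_simp
  have hL0 : 0 < L := by positivity
  have hLs : 1 ≤ s * L := by nlinarith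
  have hdist (d x y : ℝ) : dist (s * x + d) (s * y + d) ≤ s * dist x y := by
    simpa [abs_of_pos hs0] using dist_mul_add_le s d x y
  refine attractor_unique hs0.le hs1 (fun x y => by simpa using hdist 0 x y) (hdist 1) hne hK
    ⟨0, by simp [hL0.le]⟩ isCompact_Icc hinv ?_
  have e0 := Set.image_affine_Icc' hs0 0 0 L
  have e1 := Set.image_affine_Icc' hs0 1 0 L
  simp only [add_zero, mul_zero, zero_add] at e0 e1
  rw [e0, e1, Set.Icc_union_Icc' hLs (by linarith), min_eq_left zero_le_one,
    max_eq_right (by linarith)]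
  congr 1; linarith

/-- The points of `A` that maximise the linear functional `z ↦ Re (z * E)`. -/
def face (A : Set ℂ) (E : ℂ) : Set ℂ := {z ∈ A | ∀ w ∈ A, (w * E).re ≤ (z * E).re}

theorem face_real_mul (A : Set ℂ) (E : ℂ) {t : ℝ} (ht : 0 < t) : face A (t * E) = face A E := by
  have h (z : ℂ) : (z * (t * E)).re = t * (z * E).re := by
    rw [mul_left_comm, Complex.re_ofReal_mul]
  simp only [face, h, mul_le_mul_iff_right₀ ht]

theorem face_nonempty {A : Set ℂ} (hne : A.Nonempty) (hA : IsCompact A) (E : ℂ) :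
    (face A E).Nonempty := by
  have hcont : Continuous fun z : ℂ => (z * E).re := by fun_prop
  obtain ⟨z, hz, hmax⟩ := hA.exists_isMaxOn hne hcont.continuousOn
  exact ⟨z, hz, fun w hw => hmax hw⟩

theorem isCompact_face {A : Set ℂ} (hA : IsCompact A) (E : ℂ) : IsCompact (face A E) := by
  have : face A E = A ∩ ⋂ w ∈ A, {z : ℂ | (w * E).re ≤ (z * E).re} := by
    ext z; simp [face]
  rw [this]
  exact hA.inter_right (isClosed_biInter fun w _ => isClosed_le (by fun_prop) (by fun_prop))

theorem face_step {c : ℂ} {D A : Set ℂ} (hA : A = ⋃ d ∈ D, (fun z => c * z + d) '' A) (E : ℂ) :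
    face A E = ⋃ d ∈ face D E, (fun z => c * z + d) '' face A (c * E) := by
  have hre (z d : ℂ) : ((c * z + d) * E).re = (z * (c * E)).re + (d * E).re := by
    rw [← Complex.add_re]; congr 1; ring
  have hmem {z d : ℂ} (hd : d ∈ D) (hz : z ∈ A) : c * z + d ∈ A := by
    rw [hA]; exact Set.mem_biUnion hd ⟨z, hz, rfl⟩
  have hex {z : ℂ} (hz : z ∈ A) : ∃ d ∈ D, ∃ w ∈ A, c * w + d = z := by
    rw [hA] at hz; simpa using hz
  ext z
  simp only [Set.mem_iUnion, Set.mem_image, exists_prop]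
  constructor
  · rintro ⟨hz, hmax⟩
    obtain ⟨d, hd, w, hw, rfl⟩ := hex hz
    refine ⟨d, ⟨hd, fun d' hd' => ?_⟩, w, ⟨hw, fun w' hw' => ?_⟩, rfl⟩
    · have := hmax _ (hmem hd' hw)
      rw [hre, hre] at this; linarith
    · have := hmax _ (hmem hd hw')
      rw [hre, hre] at this; linarith
  · rintro ⟨d, ⟨hd, hdmax⟩, w, ⟨hw, hwmax⟩, rfl⟩
    refine ⟨hmem hd hw, fun z' hz' => ?_⟩
    obtain ⟨d', hd', w', hw', rfl⟩ := hex hz'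
    rw [hre, hre]
    exact add_le_add (hwmax w' hw') (hdmax d' hd')

theorem face_iterate {c : ℂ} {D A : Set ℂ} (hA : A = ⋃ d ∈ D, (fun z => c * z + d) '' A) (E : ℂ)
    (k : ℕ) (hD : ∀ i < k, ∃ d, face D (c ^ i * E) = {d}) :
    ∃ b, face A E = (fun z => c ^ k * z + b) '' face A (c ^ k * E) := by
  induction k with
  | zero => exact ⟨0, by simp⟩
  | succ k ih =>
    obtain ⟨b, hb⟩ := ih fun i hi => hD i (hi.trans k.lt_succ_self)
    obtain ⟨d, hd⟩ := hD k k.lt_succ_self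
    refine ⟨c ^ k * d + b, ?_⟩
    rw [hb, face_step hA, hd, Set.biUnion_singleton, Set.image_image, ← mul_assoc, ← pow_succ']
    congr 1
    ext z; ring

/-- If the direction returns to itself after `q` steps, and exactly one of these steps has two
maximising digits instead of one, then the face is invariant under two homotheties. -/
theorem face_eq_union {c : ℂ} {D A : Set ℂ} (hA : A = ⋃ d ∈ D, (fun z => c * z + d) '' A) (E : ℂ)
    {q l : ℕ} (hl : l < q) (hc : c ≠ 0) (hret : face A (c ^ q * E) = face A E)
    (hone : ∀ i < q, i ≠ l → ∃ d, face D (c ^ i * E) = {d})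
    (htwo : ∃ d₁ d₂, d₁ ≠ d₂ ∧ face D (c ^ l * E) = {d₁, d₂}) :
    ∃ b₁ b₂, b₁ ≠ b₂ ∧ face A E =
      (fun z => c ^ q * z + b₁) '' face A E ∪ (fun z => c ^ q * z + b₂) '' face A E := by
  obtain ⟨k, rfl⟩ : ∃ k, q = k + (l + 1) := ⟨q - (l + 1), by omega⟩
  obtain ⟨b, hb⟩ := face_iterate hA E l fun i hi => hone i (by omega) (by omega)
  obtain ⟨b', hb'⟩ := face_iterate hA (c ^ (l + 1) * E) k fun i hi => by
    rw [← mul_assoc, ← pow_add]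
    exact hone _ (by omega) (by omega)
  obtain ⟨d₁, d₂, hd, hD⟩ := htwo
  rw [← mul_assoc, ← pow_add, hret] at hb'
  refine ⟨c ^ l * (c * b' + d₁) + b, c ^ l * (c * b' + d₂) + b, ?_, ?_⟩
  · simpa [hc] using hd
  · conv_lhs => rw [hb, face_step hA, hD, ← mul_assoc, ← pow_succ', hb']
    simp only [Set.biUnion_insert, Set.biUnion_singleton, Set.image_union, Set.image_image]
    congr 2 <;> (ext z; ring)

theorem eq_image_of_attractor {s : ℝ} (hs0 : 0 < s) (hs1 : s < 1) {F : Set ℂ} (hFne : F.Nonempty)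
    (hF : IsCompact F) {b₁ b₂ : ℂ}
    (hFinv : F = (fun z => (s : ℂ) * z + b₁) '' F ∪ (fun z => (s : ℂ) * z + b₂) '' F)
    {K : Set ℝ} (hKne : K.Nonempty) (hK : IsCompact K)
    (hKinv : K = (fun x => s * x) '' K ∪ (fun x => s * x + 1) '' K) :
    F = (fun x : ℝ => (b₂ - b₁) * (x : ℂ) + b₁ / (1 - s)) '' K := by
  have hdist (b z w : ℂ) : dist (s * z + b) (s * w + b) ≤ s * dist z w := by
    simpa [abs_of_pos hs0] using dist_mul_add_le (s : ℂ) b z w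
  have h1s : (1 - s : ℂ) ≠ 0 := by
    rw [sub_ne_zero]; exact_mod_cast hs1.ne'
  refine attractor_unique hs0.le hs1 (hdist b₁) (hdist b₂) hFne hF (hKne.image _)
    (hK.image (by fun_prop)) hFinv ?_
  conv_lhs => rw [hKinv]
  simp only [Set.image_union, Set.image_image]
  congr 2 <;> (ext x; push_cast; field_simp; ring)

theorem cos_sub_cos_add (n : ℕ) (δ b : ℝ) :
    Real.cos (2 * Real.pi * (δ / n)) - Real.cos (2 * Real.pi * ((δ + b) / n)) =
      2 * Real.sin (Real.pi * ((2 * δ + b) / n)) * Real.sin (Real.pi * (b / n)) := by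
  rw [← neg_sub, Real.cos_sub_cos]
  have h1 : (2 * Real.pi * ((δ + b) / n) + 2 * Real.pi * (δ / n)) / 2 =
    Real.pi * ((2 * δ + b) / n) := by ring
  have h2 : (2 * Real.pi * ((δ + b) / n) - 2 * Real.pi * (δ / n)) / 2 = Real.pi * (b / n) := by
    ring
  rw [h1, h2]; ring

theorem sin_pi_mul_div_pos {n : ℕ} {x : ℝ} (hx0 : 0 < x) (hxn : x < n) :
    0 < Real.sin (Real.pi * (x / n)) := by
  have hn : (0 : ℝ) < n := hx0.trans hxn
  apply Real.sin_pos_of_pos_of_lt_pi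
  · positivity
  · have : x / n < 1 := (div_lt_one hn).2 hxn
    nlinarith [Real.pi_pos]

/-- The set of all `n`-th roots of unity. -/
def digits (n : ℕ) : Set ℂ := Set.range fun i : ℤ => xi n ^ i

theorem xi_isPrimitiveRoot {n : ℕ} (hn : n ≠ 0) : IsPrimitiveRoot (xi n) n :=
  Complex.isPrimitiveRoot_exp n hn

theorem xi_zpow_emod {n : ℕ} (hn : n ≠ 0) (i : ℤ) : xi n ^ (i % n) = xi n ^ i := by
  have h0 : xi n ≠ 0 := (xi_isPrimitiveRoot hn).ne_zero hn
  conv_rhs => rw [← Int.emod_add_mul_ediv i n, zpow_add₀ h0, zpow_mul, zpow_natCast,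
    (xi_isPrimitiveRoot hn).pow_eq_one, one_zpow, mul_one]

theorem iUnion_fin_eq_biUnion_digits {n : ℕ} (hn : n ≠ 0) (S : ℂ → Set ℂ) :
    ⋃ j : Fin n, S (xi n ^ (j : ℕ)) = ⋃ d ∈ digits n, S d := by
  simp only [digits, Set.biUnion_range]
  have hnpos : (0 : ℤ) < n := by omega
  apply Set.Subset.antisymm
  · exact Set.iUnion_subset fun j => by
      simpa using Set.subset_iUnion (fun i : ℤ => S (xi n ^ i)) (j : ℕ)
  · refine Set.iUnion_subset fun i => ?_
    have h0 := Int.emod_nonneg i hnpos.ne'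
    have h1 := Int.emod_lt_of_pos i hnpos
    have hpow : xi n ^ i = xi n ^ (i % n).toNat := by
      rw [← zpow_natCast, Int.toNat_of_nonneg h0, xi_zpow_emod hn]
    rw [hpow]
    exact Set.subset_iUnion (fun j : Fin n => S (xi n ^ (j : ℕ))) ⟨(i % n).toNat, by omega⟩

/-- The direction of argument `2πs` seen from the digits. -/
theorem re_xi_zpow_mul (n : ℕ) (ρ s : ℝ) (i : ℤ) :
    (xi n ^ i * (ρ * Complex.exp (2 * Real.pi * Complex.I * s))).re =
      ρ * Real.cos (2 * Real.pi * (i / n + s)) := by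
  rw [mul_left_comm, Complex.re_ofReal_mul, xi, ← Complex.exp_int_mul, ← Complex.exp_add]
  have : (i : ℂ) * (2 * Real.pi * Complex.I / n) + 2 * Real.pi * Complex.I * s =
      ((2 * Real.pi * (i / n + s) : ℝ) : ℂ) * Complex.I := by
    push_cast; ring
  rw [this, Complex.exp_ofReal_mul_I_re]

theorem mem_digits_iff {n : ℕ} (hn : n ≠ 0) (a : ℤ) (d : ℂ) :
    d ∈ digits n ↔ ∃ b : ℤ, 0 ≤ b ∧ b < n ∧ xi n ^ (a + b) = d := by
  constructor
  · rintro ⟨i, rfl⟩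
    have hnpos : (0 : ℤ) < n := by omega
    refine ⟨(i - a) % n, Int.emod_nonneg _ hnpos.ne', Int.emod_lt_of_pos _ hnpos, ?_⟩
    have h0 : xi n ≠ 0 := (xi_isPrimitiveRoot hn).ne_zero hn
    rw [zpow_add₀ h0, xi_zpow_emod hn, ← zpow_add₀ h0, add_sub_cancel]
  · rintro ⟨b, -, -, rfl⟩
    exact ⟨_, rfl⟩

theorem re_digit_sub {n : ℕ} (hn : n ≠ 0) (ρ s : ℝ) (a b : ℤ) :
    (xi n ^ (-a) * (ρ * Complex.exp (2 * Real.pi * Complex.I * s))).re -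
      (xi n ^ (-a + b) * (ρ * Complex.exp (2 * Real.pi * Complex.I * s))).re =
      ρ * (2 * Real.sin (Real.pi * ((2 * (n * s - a) + b) / n)) *
        Real.sin (Real.pi * (b / n))) := by
  have hn' : (n : ℝ) ≠ 0 := by exact_mod_cast hn
  rw [re_xi_zpow_mul, re_xi_zpow_mul, ← cos_sub_cos_add, mul_sub]
  congr 4 <;> (push_cast; field_simp; ring)

theorem face_digits_eq_singleton {n : ℕ} (hn : n ≠ 0) {ρ s : ℝ} (hρ : 0 < ρ)
    (hs : ∀ a : ℤ, (n * s + 1 / 2 : ℝ) ≠ a) :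
    ∃ d, face (digits n) (ρ * Complex.exp (2 * Real.pi * Complex.I * s)) = {d} := by
  set a := ⌊(n * s + 1 / 2 : ℝ)⌋ with ha
  have hlo : (a : ℝ) < n * s + 1 / 2 := lt_of_le_of_ne (Int.floor_le _) (hs a).symm
  have hhi : n * s + 1 / 2 < a + 1 := Int.lt_floor_add_one _
  have hlt (b : ℤ) (hb : 0 < b) (hbn : b < n) := by
    have hb' : (1 : ℝ) ≤ b := by exact_mod_cast hb
    have hbn' : (b : ℝ) + 1 ≤ n := by exact_mod_cast hbn
    have hpos : 0 < ρ * (2 * Real.sin (Real.pi * ((2 * (n * s - a) + b) / n)) *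
        Real.sin (Real.pi * (b / n))) :=
      mul_pos hρ (mul_pos (mul_pos two_pos (sin_pi_mul_div_pos (by linarith) (by linarith)))
        (sin_pi_mul_div_pos (by linarith) (by linarith)))
    rw [← re_digit_sub hn] at hpos
    exact sub_pos.1 hpos
  refine ⟨xi n ^ (-a), ?_⟩
  ext d
  rw [Set.mem_singleton_iff]
  constructor
  · rintro ⟨hd, hmax⟩
    obtain ⟨b, hb, hbn, rfl⟩ := (mem_digits_iff hn (-a) d).1 hd
    rcases hb.eq_or_lt with rfl | hb
    · rw [add_zero]
    · exact absurd (hmax _ ⟨-a, rfl⟩) (hlt b hb hbn).not_ge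
  · rintro rfl
    refine ⟨⟨-a, rfl⟩, fun d hd => ?_⟩
    obtain ⟨b, hb, hbn, rfl⟩ := (mem_digits_iff hn (-a) d).1 hd
    rcases hb.eq_or_lt with rfl | hb
    · rw [add_zero]
    · exact (hlt b hb hbn).le

theorem face_digits_eq_pair {n : ℕ} (hn : 2 ≤ n) {ρ s : ℝ} (hρ : 0 < ρ) {a : ℤ}
    (hs : (n * s + 1 / 2 : ℝ) = a) :
    ∃ d₁ d₂, d₁ ≠ d₂ ∧
      face (digits n) (ρ * Complex.exp (2 * Real.pi * Complex.I * s)) = {d₁, d₂} := by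
  have hn0 : n ≠ 0 := by omega
  have hsub (b : ℤ) := re_digit_sub hn0 ρ s a b
  have hδ (b : ℤ) : 2 * (n * s - a) + b = (b : ℝ) - 1 := by linarith
  simp only [hδ] at hsub
  have heq := hsub 1
  simp only [Int.cast_one, sub_self, zero_div, mul_zero, Real.sin_zero, zero_mul] at heq
  have hlt (b : ℤ) (hb : 1 < b) (hbn : b < n) := by
    have hb' : (2 : ℝ) ≤ b := by exact_mod_cast hb
    have hbn' : (b : ℝ) + 1 ≤ n := by exact_mod_cast hbn
    have hpos : 0 < ρ * (2 * Real.sin (Real.pi * (((b : ℝ) - 1) / n)) *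
        Real.sin (Real.pi * (b / n))) :=
      mul_pos hρ (mul_pos (mul_pos two_pos (sin_pi_mul_div_pos (by linarith) (by linarith)))
        (sin_pi_mul_div_pos (by linarith) (by linarith)))
    rw [← hsub] at hpos
    exact sub_pos.1 hpos
  have hle (d : ℂ) (hd : d ∈ digits n) :
      (d * (ρ * Complex.exp (2 * Real.pi * Complex.I * s))).re ≤
        (xi n ^ (-a) * (ρ * Complex.exp (2 * Real.pi * Complex.I * s))).re := by
    obtain ⟨b, hb, hbn, rfl⟩ := (mem_digits_iff hn0 (-a) d).1 hd
    rcases lt_trichotomy b 1 with h | rfl | h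
    · obtain rfl : b = 0 := by omega
      rw [add_zero]
    · linarith
    · exact (hlt b h hbn).le
  have h0 : xi n ≠ 0 := (xi_isPrimitiveRoot hn0).ne_zero hn0
  refine ⟨xi n ^ (-a), xi n ^ (-a + 1), fun h => ?_, ?_⟩
  · rw [zpow_add_one₀ h0] at h
    exact (xi_isPrimitiveRoot hn0).ne_one (by omega)
      (mul_left_cancel₀ (zpow_ne_zero (-a) h0) (by rw [← h, mul_one]))
  · ext d
    rw [Set.mem_insert_iff, Set.mem_singleton_iff]
    constructor
    · rintro ⟨hd, hmax⟩
      obtain ⟨b, hb, hbn, rfl⟩ := (mem_digits_iff hn0 (-a) d).1 hd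
      rcases lt_trichotomy b 1 with h | rfl | h
      · obtain rfl : b = 0 := by omega
        left; rw [add_zero]
      · right; rfl
      · exact absurd (hmax _ ⟨-a, rfl⟩) (hlt b h hbn).not_ge
    · rintro (rfl | rfl)
      · exact ⟨⟨_, rfl⟩, hle⟩
      · exact ⟨⟨_, rfl⟩, fun d hd => by linarith [hle d hd]⟩

theorem eq_of_natCast_mul_div_eq_intCast {n q : ℕ} {p : ℤ} (hq : 0 < q) (hpq : Int.gcd p q = 1)
    (hnq : Nat.gcd n q = 1) {i l : ℕ} (hi : i < q) (hl : l < q) {a : ℤ}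
    (h : (n * ((i - l) * ((p : ℝ) / q)) : ℝ) = a) : i = l := by
  have hq' : (q : ℝ) ≠ 0 := by exact_mod_cast hq.ne'
  have hz : (n : ℤ) * (((i : ℤ) - l) * p) = a * q := by
    field_simp at h
    have h' : (n : ℝ) * ((i - l) * p) = a * q := by linarith
    exact_mod_cast h'
  have hdvd : (q : ℤ) ∣ n * (((i : ℤ) - l) * p) := ⟨a, by rw [hz, mul_comm]⟩
  have hqn : IsCoprime (q : ℤ) n := (Nat.isCoprime_iff_coprime.2 hnq).symm
  have hqp : IsCoprime (q : ℤ) p := (Int.isCoprime_iff_gcd_eq_one.2 hpq).symm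
  have hdvd' : (q : ℤ) ∣ (i : ℤ) - l := hqp.dvd_of_dvd_mul_right (hqn.dvd_of_dvd_mul_left hdvd)
  have := Int.eq_zero_of_abs_lt_dvd hdvd' (by rw [abs_lt]; omega)
  omega

theorem image_affine_Icc_eq_segment (a z : ℂ) {L : ℝ} (hL : 0 < L) :
    (fun x : ℝ => a * (x : ℂ) + z) '' Set.Icc 0 L = segment ℝ z (a * L + z) := by
  have hIcc : Set.Icc 0 L = (fun t => L * t) '' Set.Icc (0 : ℝ) 1 := by
    simpa using (Set.image_affine_Icc' hL 0 0 1).symm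
  rw [segment_eq_image', hIcc, Set.image_image]
  congr 1
  ext t
  simp only [Complex.real_smul, add_sub_cancel_right]
  push_cast
  ring

theorem face_is_cantor_set (n : ℕ) (hn : 2 ≤ n) (p : ℤ) (q : ℕ) (hq : 0 < q)
    (hpq : Int.gcd p q = 1) (hnq : Nat.gcd n q = 1) (r : ℝ) (hr0 : 0 < r) (hr1 : r < 1)
    (c : ℂ) (hc : c = r * Complex.exp (2 * Real.pi * Complex.I * ((p : ℝ) / q)))
    (Λ : Set ℂ) (hne : Λ.Nonempty) (hcomp : IsCompact Λ)
    (hinv : Λ = ⋃ j : Fin n, (fun z => c * z + xi n ^ (j : ℕ)) '' Λ)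
    (K : Set ℝ) (hKne : K.Nonempty) (hKcomp : IsCompact K)
    (hKinv : K = (fun x => r ^ q * x) '' K ∪ (fun x => r ^ q * x + 1) '' K)
    (θ : ℝ)
    (hθ : ∃ ℓ m : ℕ, ℓ < q ∧ m < n ∧
      ((θ : ℝ) : AddCircle (1 : ℝ)) =
        (((ℓ : ℝ) * ((p : ℝ) / q) + (m : ℝ) / n + 1 / (2 * n) : ℝ) : AddCircle (1 : ℝ))) :
    (∃ a z₀ : ℂ, a ≠ 0 ∧
      {z ∈ Λ | ∀ w ∈ Λ, v θ w ≤ v θ z} = (fun x : ℝ => a * (x : ℂ) + z₀) '' K) ∧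
    (r ^ q < 1 / 2 → IsTotallyDisconnected {z ∈ Λ | ∀ w ∈ Λ, v θ w ≤ v θ z}) ∧
    ((1 : ℝ) / 2 ≤ r ^ q → ∃ u w : ℂ, u ≠ w ∧
      {z ∈ Λ | ∀ w' ∈ Λ, v θ w' ≤ v θ z} = segment ℝ u w) := by
  obtain ⟨l, m, hl, -, hθ⟩ := hθ
  obtain ⟨N, hN⟩ : ∃ N : ℤ, θ = l * ((p : ℝ) / q) + m / n + 1 / (2 * n) + N := by
    rw [← sub_eq_zero, ← AddCircle.coe_sub, AddCircle.coe_eq_zero_iff] at hθ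
    obtain ⟨N, hN⟩ := hθ
    exact ⟨N, by rw [zsmul_one] at hN; linarith⟩
  have hn0 : n ≠ 0 := by omega
  have hnR : (n : ℝ) ≠ 0 := by exact_mod_cast hn0
  have hqC : (q : ℂ) ≠ 0 := by exact_mod_cast hq.ne'
  set E := Complex.exp (-(2 * Real.pi * Complex.I) * θ) with hE
  have hface : {z ∈ Λ | ∀ w ∈ Λ, v θ w ≤ v θ z} = face Λ E := rfl
  rw [hface]
  have hc0 : c ≠ 0 := by
    rw [hc]; exact mul_ne_zero (by exact_mod_cast hr0.ne') (Complex.exp_ne_zero _)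
  have hcq : c ^ q = ((r ^ q : ℝ) : ℂ) := by
    rw [hc, mul_pow, ← Complex.exp_nat_mul]
    have : (q : ℂ) * (2 * Real.pi * Complex.I * ((p : ℝ) / q)) = p * (2 * Real.pi * Complex.I) := by
      push_cast; field_simp
    rw [this, Complex.exp_int_mul_two_pi_mul_I]
    push_cast; ring
  have hdir (i : ℕ) : c ^ i * E = ((r ^ i : ℝ) : ℂ) *
      Complex.exp (2 * Real.pi * Complex.I * ((i * ((p : ℝ) / q) - θ : ℝ) : ℂ)) := by
    rw [hc, mul_pow, ← Complex.exp_nat_mul, hE, mul_assoc, ← Complex.exp_add]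
    push_cast
    congr 2
    ring
  have hphase (i : ℕ) : (n * (i * ((p : ℝ) / q) - θ) + 1 / 2 : ℝ) =
      n * ((i - l) * ((p : ℝ) / q)) - (m + n * N : ℤ) := by
    rw [hN]; push_cast; field_simp; ring
  have hΛ : Λ = ⋃ d ∈ digits n, (fun z => c * z + d) '' Λ := by
    rw [← iUnion_fin_eq_biUnion_digits hn0 fun d => (fun z => c * z + d) '' Λ]
    exact hinv
  have hs0 : 0 < r ^ q := pow_pos hr0 q
  have hs1 : r ^ q < 1 := pow_lt_one₀ hr0.le hr1 hq.ne'
  obtain ⟨b₁, b₂, hb, hF⟩ := face_eq_union hΛ E hl hc0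
    (by rw [hcq, face_real_mul Λ E hs0])
    (fun i hi hil => by
      rw [hdir]
      refine face_digits_eq_singleton hn0 (pow_pos hr0 i) fun a ha => hil ?_
      rw [hphase, sub_eq_iff_eq_add] at ha
      exact eq_of_natCast_mul_div_eq_intCast (a := a + (m + n * N)) hq hpq hnq hi hl
        (by rw [ha]; push_cast; ring))
    (by
      rw [hdir]
      refine face_digits_eq_pair hn (pow_pos hr0 l) (a := -(m + n * N)) ?_
      rw [hphase]; push_cast; ring)
  rw [hcq] at hF
  have hFK := eq_image_of_attractor hs0 hs1 (face_nonempty hne hcomp E) (isCompact_face hcomp E) hF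
    hKne hKcomp hKinv
  have ha : b₂ - b₁ ≠ 0 := sub_ne_zero.2 hb.symm
  refine ⟨⟨_, _, ha, hFK⟩, fun hs => ?_, fun hs => ?_⟩
  · have hemb : Topology.IsEmbedding fun x : ℝ =>
        (b₂ - b₁) * (x : ℂ) + b₁ / (1 - ((r ^ q : ℝ) : ℂ)) :=
      ((Homeomorph.mulLeft₀ _ ha).trans (Homeomorph.addRight _)).isEmbedding.comp
        Complex.isometry_ofReal.isEmbedding
    rw [hFK, hemb.isTotallyDisconnected_image]
    exact isTotallyDisconnected_of_attractor hs0.le hs hKcomp hKinv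
  · have hL : 0 < 1 / (1 - r ^ q) := one_div_pos.2 (sub_pos.2 hs1)
    rw [hFK, attractor_eq_Icc hs hs1 hKne hKcomp hKinv, image_affine_Icc_eq_segment _ _ hL]
    refine ⟨_, _, fun h => ?_, rfl⟩
    exact mul_ne_zero ha (Complex.ofReal_ne_zero.2 hL.ne') (right_eq_add.1 h)
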